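/- arXiv:1609.07345 — 2 statements merged into one kernel-verified Lean document; each statement's English description precedes it below -/
import Mathlib

section
/- For the cycle graph C_n on n vertices: st_D(C_3) = st_D(C_4) = st_D(C_5) = 1, st_D(C_6) = 2, and st_D(C_n) = 3 for every n ≥ 7. -/
open SimpleGraph

/-- The distinguishing number of a graph: the least `d` such that there is a vertex
labeling with `d` labels preserved only by the trivial automorphism. -/
noncomputable def distNum {V : Type*} (G : SimpleGraph V) : ℕ :=
  sInf {d : ℕ | ∃ f : V → Fin d, ∀ φ : G ≃g G, (∀ x, f (φ x) = f x) → ∀ x, φ x = x}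

/-- The distinguishing stability of a graph: the minimum cardinality of a proper subset
`S` of the vertex set whose removal changes the distinguishing number. -/
noncomputable def stD {V : Type*} (G : SimpleGraph V) : ℕ :=
  sInf {k : ℕ | ∃ S : Set V, S ≠ Set.univ ∧ S.ncard = k ∧
    distNum (G.induce Sᶜ) ≠ distNum G}

/-- The distinguishing bondage number of a graph: the minimum cardinality of a set
of edges whose removal changes the distinguishing number. -/
noncomputable def bD {V : Type*} (G : SimpleGraph V) : ℕ :=
  sInf {k : ℕ | ∃ F : Set (Sym2 V), F ⊆ G.edgeSet ∧ F.ncard = k ∧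
    distNum (G.deleteEdges F) ≠ distNum G}

/-- `G` has a distinguishing labeling with `d` labels. -/
def HasDist {V : Type*} (G : SimpleGraph V) (d : ℕ) : Prop :=
  ∃ f : V → Fin d, ∀ φ : G ≃g G, (∀ x, f (φ x) = f x) → ∀ x, φ x = x

theorem HasDist.mono {V : Type*} {G : SimpleGraph V} {d e : ℕ} (hde : d ≤ e)
    (h : HasDist G d) : HasDist G e := by
  obtain ⟨f, hf⟩ := h
  refine ⟨fun x => Fin.castLE hde (f x), fun φ hφ => hf φ fun x => ?_⟩
  exact Fin.castLE_injective hde (hφ x)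

theorem hasDist_card {n : ℕ} (G : SimpleGraph (Fin n)) : HasDist G n :=
  ⟨id, fun _ h => h⟩

theorem distNum_le {V : Type*} {G : SimpleGraph V} {d : ℕ} (h : HasDist G d) :
    distNum G ≤ d := Nat.sInf_le h

theorem lt_distNum {V : Type*} {G : SimpleGraph V} {d e : ℕ} (h : ¬ HasDist G d)
    (he : HasDist G e) : d < distNum G := by
  by_contra hlt
  have hm : HasDist G (distNum G) := Nat.sInf_mem (s := {d | HasDist G d}) ⟨e, he⟩
  exact h (hm.mono (by omega))

theorem distNum_eq_two {V : Type*} {G : SimpleGraph V} (h2 : HasDist G 2)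
    (h1 : ¬ HasDist G 1) : distNum G = 2 := by
  have := distNum_le h2
  have := lt_distNum h1 h2
  omega

theorem distNum_ne_two {V : Type*} {G : SimpleGraph V} (h2 : ¬ HasDist G 2) :
    distNum G ≠ 2 := by
  intro h
  have hne : (({d | HasDist G d} : Set ℕ)).Nonempty := by
    by_contra hne
    rw [Set.not_nonempty_iff_eq_empty] at hne
    have : distNum G = sInf {d | HasDist G d} := rfl
    rw [hne, Nat.sInf_empty] at this
    omega
  have hm : HasDist G (distNum G) := Nat.sInf_mem hne
  rw [h] at hm
  exact h2 hm

theorem HasDist.iso {V W : Type*} {G : SimpleGraph V} {H : SimpleGraph W} {d : ℕ}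
    (e : G ≃g H) (h : HasDist G d) : HasDist H d := by
  obtain ⟨f, hf⟩ := h
  refine ⟨fun x => f (e.symm x), fun φ hφ x => ?_⟩
  have := hf ((e.trans φ).trans e.symm) (fun y => by simpa using hφ (e y)) (e.symm x)
  simpa using this

theorem distNum_iso {V W : Type*} {G : SimpleGraph V} {H : SimpleGraph W}
    (e : G ≃g H) : distNum G = distNum H := by
  have : {d | HasDist G d} = {d | HasDist H d} := by
    ext d
    exact ⟨fun h => HasDist.iso e h, fun h => HasDist.iso e.symm h⟩
  exact congrArg sInf this

/-- An automorphism restricts to an isomorphism of induced subgraphs. -/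
def induceIso {V : Type*} {G : SimpleGraph V} (σ : G ≃g G) {s t : Set V}
    (h : ∀ x, x ∈ s ↔ σ x ∈ t) : G.induce s ≃g G.induce t where
  toEquiv := σ.toEquiv.subtypeEquiv h
  map_rel_iff' := by
    intro a b
    exact σ.map_adj_iff

/-- An involutive homomorphism is an automorphism. -/
def involIso {V : Type*} {G : SimpleGraph V} (g : V → V) (hg : ∀ x, g (g x) = x)
    (h : ∀ x y, G.Adj x y → G.Adj (g x) (g y)) : G ≃g G where
  toFun := g
  invFun := g
  left_inv := hg
  right_inv := hg
  map_rel_iff' := by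
    intro a b
    refine ⟨fun hab => ?_, h a b⟩
    have := h _ _ hab
    simpa [hg] using this

/-- Translations of the cycle. -/
def rotIso {n : ℕ} (c : Fin (n + 2)) : cycleGraph (n + 2) ≃g cycleGraph (n + 2) where
  toEquiv := Equiv.addRight c
  map_rel_iff' := by
    intro a b
    simp [cycleGraph_adj]

/-- Reflections of the cycle. -/
def reflIso {n : ℕ} (c : Fin (n + 2)) : cycleGraph (n + 2) ≃g cycleGraph (n + 2) where
  toEquiv := Equiv.subLeft c
  map_rel_iff' := by
    intro a b
    simp only [cycleGraph_adj, Equiv.subLeft_apply, sub_sub_sub_cancel_left]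
    exact or_comm

theorem adj_iff {n : ℕ} (hn : 3 ≤ n) (u v : Fin n) : (cycleGraph n).Adj u v ↔
    u.val + 1 = v.val ∨ v.val + 1 = u.val ∨ (u.val = 0 ∧ v.val + 1 = n) ∨
      (v.val = 0 ∧ u.val + 1 = n) := by
  rw [cycleGraph_adj']
  obtain ⟨u, hu⟩ := u
  obtain ⟨v, hv⟩ := v
  simp only [Fin.sub_def]
  have key : ∀ a b : ℕ, a < n → b < n → ((n - b + a) % n = 1 ↔ b + 1 = a ∨ (a = 0 ∧ b + 1 = n)) := by
    intro a b ha hb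
    rcases Nat.lt_or_ge a b with h | h
    · rw [Nat.mod_eq_of_lt (by omega)]; omega
    · rw [Nat.mod_eq_sub_mod (by omega), Nat.mod_eq_of_lt (by omega)]; omega
  rw [key u v hu hv, key v u hv hu]
  omega

theorem fix_step {W : Type*} {H : SimpleGraph W} (φ : H ≃g H) {x y : W} (hx : φ x = x)
    (hxy : H.Adj x y) (h : ∀ z, H.Adj x z → z = y ∨ φ z = z) : φ y = y := by
  have h1 : H.Adj x (φ y) := by
    have := φ.map_adj_iff.2 hxy
    rwa [hx] at this
  rcases h _ h1 with h | h
  · exact h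
  · exact φ.injective h

theorem label_iff {W : Type*} {H : SimpleGraph W} (φ : H ≃g H) (L : W → Prop) [DecidablePred L]
    (h : ∀ x, (if L (φ x) then (1 : Fin 2) else 0) = if L x then 1 else 0) (x : W) :
    L (φ x) ↔ L x := by
  have := h x
  by_cases h1 : L (φ x) <;> by_cases h2 : L x <;> simp_all

/-- Two labels distinguish the cycle with at least 6 vertices. -/
theorem hasDist_cycle {n : ℕ} (hn : 6 ≤ n) : HasDist (cycleGraph n) 2 := by
  refine ⟨fun x => if x.val = 0 ∨ x.val = 1 ∨ x.val = 3 then 1 else 0, fun φ hφ => ?_⟩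
  have hL := label_iff φ (fun x : Fin n => x.val = 0 ∨ x.val = 1 ∨ x.val = 3) hφ
  have hadj : ∀ x y : Fin n, _ := fun x y => (φ.map_adj_iff (v := x) (w := y)).2
  simp only [adj_iff (by omega : 3 ≤ n)] at hadj
  have l0 := (hL ⟨0, by omega⟩).2 (by simp)
  have l1 := (hL ⟨1, by omega⟩).2 (by simp)
  have l2 := mt (hL ⟨2, by omega⟩).1 (by simp)
  have l3 := (hL ⟨3, by omega⟩).2 (by simp)
  have a01 := hadj ⟨0, by omega⟩ ⟨1, by omega⟩ (by simp)
  have a12 := hadj ⟨1, by omega⟩ ⟨2, by omega⟩ (by simp)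
  have a23 := hadj ⟨2, by omega⟩ ⟨3, by omega⟩ (by simp)
  have hi : ∀ x y : Fin n, x.val ≠ y.val → (φ x).val ≠ (φ y).val := fun x y hxy h =>
    hxy (congrArg Fin.val (φ.injective (Fin.ext h)))
  have i03 := hi ⟨0, by omega⟩ ⟨3, by omega⟩ (by simp)
  have i13 := hi ⟨1, by omega⟩ ⟨3, by omega⟩ (by simp)
  have i02 := hi ⟨0, by omega⟩ ⟨2, by omega⟩ (by simp)
  have f0 : (φ ⟨0, by omega⟩).val = 0 := by omega
  have f1 : (φ ⟨1, by omega⟩).val = 1 := by omega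
  have key : ∀ k, ∀ w : Fin n, w.val = k → φ w = w := by
    intro k
    induction k using Nat.strong_induction_on with
    | _ k ih =>
      intro w hw
      by_cases h0 : k = 0
      · have h0n : 0 < n := by omega
        obtain rfl : (⟨0, h0n⟩ : Fin n) = w := Fin.ext (by simp only; omega)
        exact Fin.ext f0
      by_cases h1 : k = 1
      · have h0n : 1 < n := by omega
        obtain rfl : (⟨1, h0n⟩ : Fin n) = w := Fin.ext (by simp only; omega)
        exact Fin.ext f1
      have hwn := w.isLt
      refine fix_step φ (x := ⟨k - 1, by omega⟩) (ih (k - 1) (by omega) _ rfl) ?_ ?_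
      · rw [adj_iff (by omega)]; simp only; omega
      · intro z hz
        rw [adj_iff (by omega)] at hz
        simp only at hz
        by_cases hzk : z.val = k
        · exact Or.inl (Fin.ext (by omega))
        · exact Or.inr (ih z.val (by omega) z rfl)
  exact fun x => key _ x rfl

/-- Two labels distinguish the cycle minus `{0, b}`. -/
theorem hasDist_minus {n b : ℕ} (hb : b + 4 ≤ n) (hb2 : 2 * b ≤ n) :
    HasDist ((cycleGraph n).induce {x : Fin n | x.val = 0 ∨ x.val = b}ᶜ) 2 := by
  have hn : 3 ≤ n := by omega
  set T : Set (Fin n) := {x : Fin n | x.val = 0 ∨ x.val = b}ᶜ with hT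
  have memT : ∀ x : Fin n, x ∈ T ↔ ¬ (x.val = 0 ∨ x.val = b) := fun x => Iff.rfl
  have memW : ∀ x : T, ¬ (x.val.val = 0 ∨ x.val.val = b) := fun x => x.2
  refine ⟨fun x => if x.val.val = 1 ∨ x.val.val = b + 1 ∨ x.val.val = b + 2 then 1 else 0,
    fun φ hφ => ?_⟩
  have hL := label_iff φ
    (fun x : T => x.val.val = 1 ∨ x.val.val = b + 1 ∨ x.val.val = b + 2) hφ
  have wext : ∀ x y : T, x.val.val = y.val.val → x = y := fun x y h =>
    Subtype.ext (Fin.ext h)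
  have wadj : ∀ x y : T, ((cycleGraph n).induce T).Adj x y ↔ _ := fun x y =>
    (adj_iff hn x.val y.val)
  have hadj : ∀ x y : T, _ := fun x y => (φ.map_adj_iff (v := x) (w := y)).2
  simp only [wadj] at hadj
  have hi : ∀ x y : T, x.val.val ≠ y.val.val → (φ x).val.val ≠ (φ y).val.val := fun x y hxy h =>
    hxy (congrArg (fun z : T => z.val.val) (φ.injective (wext _ _ h)))
  have mk : ∀ k, k < n → k ≠ 0 → k ≠ b → ∃ w : T, w.val.val = k := fun k h1 h2 h3 =>
    ⟨⟨⟨k, h1⟩, by rw [memT]; simp only; omega⟩, rfl⟩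
  obtain ⟨p, hp⟩ := mk (b + 1) (by omega) (by omega) (by omega)
  obtain ⟨q, hq⟩ := mk (b + 2) (by omega) (by omega) (by omega)
  obtain ⟨r, hr⟩ := mk (b + 3) (by omega) (by omega) (by omega)
  have lp := hL p
  have lq := hL q
  have apq := hadj p q (by omega)
  have aqr := hadj q r (by omega)
  have ipr := hi p r (by omega)
  have mp := memW (φ p)
  have mq := memW (φ q)
  have mr := memW (φ r)
  have fp : (φ p).val.val = b + 1 := by omega
  have fq : (φ q).val.val = b + 2 := by omega
  have keyB : ∀ k, b + 1 ≤ k → ∀ w : T, w.val.val = k → φ w = w := by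
    intro k
    induction k using Nat.strong_induction_on with
    | _ k ih =>
      intro hk w hw
      by_cases h0 : k = b + 1
      · have : w = p := wext _ _ (by omega)
        subst this
        exact wext _ _ (by omega)
      by_cases h1 : k = b + 2
      · have : w = q := wext _ _ (by omega)
        subst this
        exact wext _ _ (by omega)
      have hwn := w.val.isLt
      obtain ⟨x, hx⟩ := mk (k - 1) (by omega) (by omega) (by omega)
      refine fix_step φ (x := x) (ih (k - 1) (by omega) (by omega) _ hx) ?_ ?_
      · rw [wadj]; omega
      · intro z hz
        rw [wadj] at hz
        by_cases hzk : z.val.val = k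
        · exact Or.inl (wext _ _ (by omega))
        · exact Or.inr (ih z.val.val (by omega) (by omega) z rfl)
  have keyA : ∀ k, k < b → ∀ w : T, w.val.val = k → φ w = w := by
    intro k
    induction k using Nat.strong_induction_on with
    | _ k ih =>
      intro hk w hw
      have mw := memW w
      by_cases h1 : k = 1
      · have lw := hL w
        have i1 := hi w p (by omega)
        have i2 := hi w q (by omega)
        exact wext _ _ (by omega)
      obtain ⟨x, hx⟩ := mk (k - 1) (by omega) (by omega) (by omega)
      refine fix_step φ (x := x) (ih (k - 1) (by omega) (by omega) _ hx) ?_ ?_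
      · rw [wadj]; omega
      · intro z hz
        rw [wadj] at hz
        have mz := memW z
        by_cases hzk : z.val.val = k
        · exact Or.inl (wext _ _ (by omega))
        · exact Or.inr (ih z.val.val (by omega) (by omega) z rfl)
  intro x
  have mx := memW x
  rcases Nat.lt_or_ge x.val.val b with h | h
  · exact keyA _ h x rfl
  · exact keyB _ (by omega) x rfl

/-- A graph with two isolated edges `ab` and `cd` is not distinguished by two labels. -/
theorem not_hasDist_two_edges {W : Type*} (H : SimpleGraph W) (a b c d : W)
    (ac : a ≠ c) (ad : a ≠ d) (bc : b ≠ c) (bd : b ≠ d)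
    (adjab : H.Adj a b) (adjcd : H.Adj c d)
    (na : ∀ y, H.Adj a y → y = b) (nb : ∀ y, H.Adj b y → y = a)
    (nc : ∀ y, H.Adj c y → y = d) (nd : ∀ y, H.Adj d y → y = c) : ¬ HasDist H 2 := by
  classical
  rintro ⟨f, hf⟩
  have ab : a ≠ b := adjab.ne
  have cd : c ≠ d := adjcd.ne
  have main : ∀ g : W → W, (∀ x, g (g x) = x) →
      (∀ x, x = a ∨ x = b ∨ x = c ∨ x = d ∨ g x = x) →
      H.Adj (g a) (g b) → H.Adj (g c) (g d) →
      (f (g a) = f a ∧ f (g b) = f b ∧ f (g c) = f c ∧ f (g d) = f d) →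
      ∀ x, g x = x := by
    intro g hg four pab pcd hfg
    have hhom : ∀ x y, H.Adj x y → H.Adj (g x) (g y) := by
      intro x y hxy
      rcases four x with h | h | h | h | h
      · subst h; rw [na y hxy]; exact pab
      · subst h; rw [nb y hxy]; exact pab.symm
      · subst h; rw [nc y hxy]; exact pcd
      · subst h; rw [nd y hxy]; exact pcd.symm
      · rcases four y with h' | h' | h' | h' | h'
        · subst h'; rw [na x hxy.symm]; exact pab.symm
        · subst h'; rw [nb x hxy.symm]; exact pab
        · subst h'; rw [nc x hxy.symm]; exact pcd.symm
        · subst h'; rw [nd x hxy.symm]; exact pcd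
        · rwa [h, h']
    refine hf (involIso g hg hhom) fun x => ?_
    change f (g x) = f x
    rcases four x with h | h | h | h | h
    · subst h; exact hfg.1
    · subst h; exact hfg.2.1
    · subst h; exact hfg.2.2.1
    · subst h; exact hfg.2.2.2
    · rw [h]
  have adjba := adjab.symm
  have adjdc := adjcd.symm
  clear hf na nb nc nd
  by_cases e1 : f a = f b
  · have := main (fun x => if x = a then b else if x = b then a else x)
      (by clear main; grind) (by clear main; grind) (by clear main; grind) (by clear main; grind)
      (by clear main; grind) a
    grind
  by_cases e2 : f c = f d
  · have := main (fun x => if x = c then d else if x = d then c else x)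
      (by clear main; grind) (by clear main; grind) (by clear main; grind) (by clear main; grind)
      (by clear main; grind) c
    grind
  have e3 : (f a = f c ∧ f b = f d) ∨ (f a = f d ∧ f b = f c) := by omega
  rcases e3 with e3 | e3
  · have := main (fun x => if x = a then c else if x = c then a else if x = b then d else
      if x = d then b else x)
      (by clear main; grind) (by clear main; grind) (by clear main; grind) (by clear main; grind)
      (by clear main; grind) a
    grind
  · have := main (fun x => if x = a then d else if x = d then a else if x = b then c else
      if x = c then b else x)
      (by clear main; grind) (by clear main; grind) (by clear main; grind) (by clear main; grind)
      (by clear main; grind) a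
    grind

/-- The cycle minus `{0, 3, 6}` is not distinguished by two labels. -/
theorem not_hasDist_minus {n : ℕ} (hn : 6 ≤ n) :
    ¬ HasDist ((cycleGraph n).induce {x : Fin n | x.val = 0 ∨ x.val = 3 ∨ x.val = 6}ᶜ) 2 := by
  set T : Set (Fin n) := {x : Fin n | x.val = 0 ∨ x.val = 3 ∨ x.val = 6}ᶜ with hT
  have memT : ∀ x : Fin n, x ∈ T ↔ ¬ (x.val = 0 ∨ x.val = 3 ∨ x.val = 6) := fun x => Iff.rfl
  have memW : ∀ x : T, ¬ (x.val.val = 0 ∨ x.val.val = 3 ∨ x.val.val = 6) := fun x => x.2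
  have wext : ∀ x y : T, x.val.val = y.val.val → x = y := fun x y h =>
    Subtype.ext (Fin.ext h)
  have wadj : ∀ x y : T, ((cycleGraph n).induce T).Adj x y ↔ _ := fun x y =>
    (adj_iff (by omega) x.val y.val)
  have mk : ∀ k, k < n → k ≠ 0 → k ≠ 3 → k ≠ 6 → ∃ w : T, w.val.val = k := fun k h1 h2 h3 h4 =>
    ⟨⟨⟨k, h1⟩, by rw [memT]; simp only; omega⟩, rfl⟩
  obtain ⟨a, ha⟩ := mk 1 (by omega) (by omega) (by omega) (by omega)
  obtain ⟨b, hb⟩ := mk 2 (by omega) (by omega) (by omega) (by omega)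
  obtain ⟨c, hc⟩ := mk 4 (by omega) (by omega) (by omega) (by omega)
  obtain ⟨d, hd⟩ := mk 5 (by omega) (by omega) (by omega) (by omega)
  refine not_hasDist_two_edges _ a b c d ?_ ?_ ?_ ?_ ?_ ?_ ?_ ?_ ?_ ?_
  · intro h; rw [h] at ha; omega
  · intro h; rw [h] at ha; omega
  · intro h; rw [h] at hb; omega
  · intro h; rw [h] at hb; omega
  · rw [wadj]; omega
  · rw [wadj]; omega
  all_goals
    intro y hy
    rw [wadj] at hy
    have := memW y
    have := y.val.isLt
    exact wext _ _ (by omega)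

/-- A cycle with at least 5 vertices minus one or two vertices has a nontrivial symmetry. -/
theorem not_hasDist_pair {n : ℕ} (hn : 3 ≤ n) (a b : Fin (n + 2)) :
    ¬ HasDist ((cycleGraph (n + 2)).induce ({a, b} : Set (Fin (n + 2)))ᶜ) 1 := by
  rintro ⟨f, hf⟩
  have hσ : ∀ x, x ∈ ({a, b} : Set (Fin (n + 2)))ᶜ ↔
      reflIso (a + b) x ∈ ({a, b} : Set (Fin (n + 2)))ᶜ := by
    intro x
    change _ ↔ a + b - x ∈ _
    simp only [Set.mem_compl_iff, Set.mem_insert_iff, Set.mem_singleton_iff, not_iff_not]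
    constructor
    · rintro (h | h) <;> subst h <;> simp
    · rintro (h | h)
      · right; have := sub_eq_iff_eq_add.1 h; exact (add_left_cancel this).symm
      · left; rw [add_comm a b] at h; have := sub_eq_iff_eq_add.1 h; exact (add_left_cancel this).symm
  have h := hf (induceIso (reflIso (a + b)) hσ) (fun x => Subsingleton.elim _ _)
  have h' : ∀ x, x ≠ a → x ≠ b → a + b - x = x := fun x hxa hxb =>
    congrArg Subtype.val (h ⟨x, by simp [hxa, hxb]⟩)
  have pair : ∀ x, x ≠ a → x ≠ b → x + 1 ≠ a → x + 1 ≠ b → False := by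
    intro x h1 h2 h3 h4
    have e1 := sub_eq_iff_eq_add.1 (h' x h1 h2)
    have e2 := sub_eq_iff_eq_add.1 (h' (x + 1) h3 h4)
    rw [e1] at e2
    have e3 : (0 : Fin (n + 2)) = 1 + 1 := by
      have : x + x + 0 = x + x + (1 + 1) := by rw [add_zero]; refine e2.trans ?_; abel
      exact add_left_cancel this
    have := congrArg Fin.val e3
    rw [Fin.val_add, Fin.val_zero, Fin.val_one, Nat.mod_eq_of_lt (by omega)] at this
    omega
  have small : ∀ i j : ℕ, i < n + 2 → j < n + 2 → i ≠ j →
      a + Fin.ofNat (n + 2) i ≠ a + Fin.ofNat (n + 2) j := by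
    intro i j hi hj hij h
    have := congrArg Fin.val (add_left_cancel h)
    simp only [Fin.ofNat, Nat.mod_eq_of_lt hi, Nat.mod_eq_of_lt hj] at this
    exact hij this
  have succ : ∀ i : ℕ, a + Fin.ofNat (n + 2) i + 1 = a + Fin.ofNat (n + 2) (i + 1) := by
    intro i
    rw [add_assoc]
    congr 1
    apply Fin.ext
    simp [Fin.val_add, Fin.ofNat]
  have zero : a + Fin.ofNat (n + 2) 0 = a := by simp [Fin.ofNat]
  have nz : ∀ i : ℕ, 0 < i → i < n + 2 → a + Fin.ofNat (n + 2) i ≠ a := by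
    intro i h0 hi h
    exact small i 0 hi (by omega) (by omega) (h.trans zero.symm)
  by_cases c1 : a + Fin.ofNat (n + 2) 1 = b ∨ a + Fin.ofNat (n + 2) 2 = b
  · refine pair (a + Fin.ofNat (n + 2) 3) (nz 3 (by omega) (by omega)) ?_ ?_ ?_
    · intro h
      rcases c1 with c | c
      · exact small 3 1 (by omega) (by omega) (by omega) (h.trans c.symm)
      · exact small 3 2 (by omega) (by omega) (by omega) (h.trans c.symm)
    · rw [succ]; exact nz 4 (by omega) (by omega)
    · rw [succ]
      intro h
      rcases c1 with c | c
      · exact small 4 1 (by omega) (by omega) (by omega) (h.trans c.symm)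
      · exact small 4 2 (by omega) (by omega) (by omega) (h.trans c.symm)
  · push Not at c1
    refine pair (a + Fin.ofNat (n + 2) 1) (nz 1 (by omega) (by omega)) c1.1 ?_ ?_
    · rw [succ]; exact nz 2 (by omega) (by omega)
    · rw [succ]; exact c1.2

theorem not_hasDist_cycle {n : ℕ} (hn : 1 ≤ n) : ¬ HasDist (cycleGraph (n + 2)) 1 := by
  rintro ⟨f, hf⟩
  have h := hf (rotIso 1) (fun x => Subsingleton.elim _ _) 0
  have h2 : (0 : Fin (n + 2)) + 1 = 0 := h
  simp at h2

theorem hasDist_pair_aux {n : ℕ} (a b : Fin (n + 2)) (h4 : (b - a).val + 4 ≤ n + 2)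
    (h2 : 2 * (b - a).val ≤ n + 2) :
    HasDist ((cycleGraph (n + 2)).induce ({a, b} : Set (Fin (n + 2)))ᶜ) 2 := by
  refine HasDist.iso (induceIso (rotIso a) ?_) (hasDist_minus h4 h2)
  intro x
  change _ ↔ x + a ∈ _
  simp only [Set.mem_compl_iff, Set.mem_insert_iff, Set.mem_singleton_iff, not_iff_not,
    Set.mem_ofPred_eq]
  rw [← Fin.ext_iff, eq_sub_iff_add_eq, add_eq_right]
  have h0 : x.val = 0 ↔ x = 0 := by rw [Fin.ext_iff, Fin.val_zero]
  rw [h0]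

theorem sub_val_add {n : ℕ} (a b : Fin (n + 2)) (h : a ≠ b) :
    (b - a).val + (a - b).val = n + 2 := by
  have h1 : a - b ≠ 0 := sub_ne_zero.2 h
  have h2 : b - a = -(a - b) := by abel
  rw [h2, Fin.val_neg, if_neg h1]
  omega

theorem hasDist_pair {n : ℕ} (hn : 5 ≤ n) (a b : Fin (n + 2)) :
    HasDist ((cycleGraph (n + 2)).induce ({a, b} : Set (Fin (n + 2)))ᶜ) 2 := by
  by_cases h : a = b
  · apply hasDist_pair_aux <;> simp [h]; omega
  have hs := sub_val_add a b h
  by_cases hle : 2 * (b - a).val ≤ n + 2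
  · exact hasDist_pair_aux a b (by omega) hle
  · rw [Set.pair_comm]
    exact hasDist_pair_aux b a (by omega) (by omega)

theorem hasDist_single {n : ℕ} (hn : 2 ≤ n) (a : Fin (n + 2)) :
    HasDist ((cycleGraph (n + 2)).induce ({a, a} : Set (Fin (n + 2)))ᶜ) 2 := by
  apply hasDist_pair_aux <;> simp
  omega

theorem distNum_induce_empty {V : Type*} (G : SimpleGraph V) :
    distNum (G.induce (∅ : Set V)ᶜ) = distNum G := by
  apply distNum_iso
  rw [Set.compl_empty]
  exact SimpleGraph.induceUnivIso G

theorem stD_eq {V : Type*} (G : SimpleGraph V) (k : ℕ) (S : Set V) (h1 : S ≠ Set.univ)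
    (h2 : S.ncard = k) (h3 : distNum (G.induce Sᶜ) ≠ distNum G)
    (h : ∀ S : Set V, S.ncard < k → distNum (G.induce Sᶜ) = distNum G) : stD G = k := by
  apply le_antisymm
  · exact Nat.sInf_le ⟨S, h1, h2, h3⟩
  · refine le_csInf ⟨k, S, h1, h2, h3⟩ ?_
    rintro m ⟨S', -, h2', h3'⟩
    by_contra hlt
    exact h3' (h S' (by omega))

theorem stD_eq_one {n : ℕ} (hn : 1 ≤ n)
    (hc : ¬ HasDist (cycleGraph (n + 2)) 2)
    (hp : HasDist ((cycleGraph (n + 2)).induce ({0, 0} : Set (Fin (n + 2)))ᶜ) 2) :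
    stD (cycleGraph (n + 2)) = 1 := by
  refine stD_eq _ 1 {0, 0} ?_ (by simp) ?_ ?_
  · intro h
    have : (1 : Fin (n + 2)) ∈ ({0, 0} : Set (Fin (n + 2))) := by rw [h]; trivial
    simp at this
  · have h1 := distNum_le hp
    have h2 := lt_distNum hc (hasDist_card _)
    omega
  · intro S hS
    have : S = ∅ := by
      rw [← Set.ncard_eq_zero]
      omega
    subst this
    exact distNum_induce_empty _

theorem not_hasDist_of_refl {n : ℕ} (hn : 1 ≤ n)
    (h : ∀ f : Fin (n + 2) → Fin 2, ∃ c, (∀ x, f (c - x) = f x) ∧ ∃ x, c - x ≠ x) :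
    ¬ HasDist (cycleGraph (n + 2)) 2 := by
  rintro ⟨f, hf⟩
  obtain ⟨c, h1, x, hx⟩ := h f
  exact hx (hf (reflIso c) h1 x)

theorem hasDist_three :
    HasDist ((cycleGraph (1 + 2)).induce ({0, 0} : Set (Fin (1 + 2)))ᶜ) 2 := by
  refine ⟨fun x => if x.val.val = 1 then 1 else 0, fun φ hφ x => ?_⟩
  have hL := label_iff φ (fun x => x.val.val = 1) hφ x
  have h0 : ∀ y : (({0, 0} : Set (Fin (1 + 2)))ᶜ : Set _), y.val.val ≠ 0 := by
    intro y h
    have := y.2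
    simp at this
    exact this (Fin.ext h)
  have h1 := h0 x
  have h2 := h0 (φ x)
  exact Subtype.ext (Fin.ext (by omega))

theorem ncard_lt {n k : ℕ} (hn : 6 ≤ n) (S : Set (Fin n)) (hS : S.ncard < k) (hk : k ≤ 3)
    (h : ∀ a b : Fin n, ({a, b} : Set (Fin n)).ncard < k →
      distNum ((cycleGraph n).induce ({a, b} : Set (Fin n))ᶜ) = distNum (cycleGraph n)) :
    distNum ((cycleGraph n).induce Sᶜ) = distNum (cycleGraph n) := by
  have h3 : S.ncard = 0 ∨ S.ncard = 1 ∨ S.ncard = 2 := by omega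
  rcases h3 with h3 | h3 | h3
  · rw [Set.ncard_eq_zero] at h3
    subst h3
    exact distNum_induce_empty _
  · obtain ⟨a, rfl⟩ := Set.ncard_eq_one.1 h3
    rw [← Set.pair_eq_singleton] at hS ⊢
    exact h a a hS
  · obtain ⟨a, b, -, rfl⟩ := Set.ncard_eq_two.1 h3
    exact h a b hS

theorem distNum_cycle {n : ℕ} (hn : 6 ≤ n) : distNum (cycleGraph n) = 2 := by
  obtain ⟨m, rfl⟩ : ∃ m, n = m + 2 := ⟨n - 2, by omega⟩
  exact distNum_eq_two (hasDist_cycle hn) (not_hasDist_cycle (by omega))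

theorem stD_large {n k : ℕ} (hn : 6 ≤ n) (hk : k ≤ 3)
    (hcard : ({x : Fin n | x.val = 0 ∨ x.val = 3 ∨ x.val = 6}).ncard = k)
    (h : ∀ a b : Fin n, ({a, b} : Set (Fin n)).ncard < k →
      HasDist ((cycleGraph n).induce ({a, b} : Set (Fin n))ᶜ) 2) :
    stD (cycleGraph n) = k := by
  refine stD_eq _ k _ ?_ hcard ?_ ?_
  · intro h
    have : (⟨1, by omega⟩ : Fin n) ∈ {x : Fin n | x.val = 0 ∨ x.val = 3 ∨ x.val = 6} := by
      rw [h]; trivial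
    simp at this
  · rw [distNum_cycle hn]
    exact distNum_ne_two (not_hasDist_minus hn)
  · intro S hS
    refine ncard_lt hn S hS hk fun a b hab => ?_
    rw [distNum_cycle hn]
    refine distNum_eq_two (h a b hab) ?_
    obtain ⟨m, rfl⟩ : ∃ m, n = m + 2 := ⟨n - 2, by omega⟩
    exact not_hasDist_pair (by omega) a b

/-- Distinguishing stability of cycles. -/
theorem stD_cycleGraph :
    stD (cycleGraph 3) = 1 ∧ stD (cycleGraph 4) = 1 ∧ stD (cycleGraph 5) = 1 ∧
      stD (cycleGraph 6) = 2 ∧ ∀ n : ℕ, 7 ≤ n → stD (cycleGraph n) = 3 := by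
  refine ⟨?_, ?_, ?_, ?_, ?_⟩
  · exact stD_eq_one (n := 1) (by omega) (not_hasDist_of_refl (by omega) (by decide)) hasDist_three
  · exact stD_eq_one (n := 2) (by omega) (not_hasDist_of_refl (by omega) (by decide))
      (hasDist_single (by omega) 0)
  · exact stD_eq_one (n := 3) (by omega) (not_hasDist_of_refl (by omega) (by decide))
      (hasDist_single (by omega) 0)
  · refine stD_large (by omega) (by omega) ?_ ?_
    · have : {x : Fin 6 | x.val = 0 ∨ x.val = 3 ∨ x.val = 6} = {0, 3} := by
        ext x
        simp only [Set.mem_ofPred_eq, Set.mem_insert_iff, Set.mem_singleton_iff, Fin.ext_iff]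
        have := x.isLt
        change _ ↔ x.val = 0 ∨ x.val = 3
        omega
      rw [this, Set.ncard_pair (by decide)]
    · intro a b hab
      have : a = b := by
        by_contra hne
        rw [Set.ncard_pair hne] at hab
        omega
      subst this
      exact hasDist_single (n := 4) (by omega) a
  · intro n hn
    refine stD_large (by omega) (by omega) ?_ ?_
    · have : {x : Fin n | x.val = 0 ∨ x.val = 3 ∨ x.val = 6} =
          {⟨0, by omega⟩, ⟨3, by omega⟩, ⟨6, by omega⟩} := by
        ext x
        simp only [Set.mem_ofPred_eq, Set.mem_insert_iff, Set.mem_singleton_iff, Fin.ext_iff]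
      rw [this, Set.ncard_eq_three]
      exact ⟨_, _, _, by simp, by simp, by simp, rfl⟩
    · intro a b _
      obtain ⟨m, rfl⟩ : ∃ m, n = m + 2 := ⟨n - 2, by omega⟩
      exact hasDist_pair (by omega) a b
end

section
/- For every n ≥ 3 and m ≥ 2, the distinguishing bondage numbers of the complete graph and the complete bipartite graph satisfy b_D(K_n) = 1 and b_D(K_{n,m}) = 1. -/
open SimpleGraph

/-- A labeling is distinguishing. -/
def IsDist {V : Type*} {α : Type*} (G : SimpleGraph V) (f : V → α) : Prop :=
  ∀ φ : G ≃g G, (∀ x, f (φ x) = f x) → ∀ x, φ x = x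

theorem bD_eq_one_of {V : Type*} [Fintype V] (G : SimpleGraph V) (e : Sym2 V)
    (he : e ∈ G.edgeSet) (d : ℕ) (f : V → Fin d) (hf : IsDist (G.deleteEdges {e}) f)
    (hG : ∀ (k : ℕ) (g : V → Fin k), IsDist G g → d < k) : bD G = 1 := by
  have h1 : distNum (G.deleteEdges {e}) ≤ d := Nat.sInf_le ⟨f, hf⟩
  have h2 : d < distNum G := by
    have hne : {d : ℕ | ∃ f : V → Fin d, ∀ φ : G ≃g G,
        (∀ x, f (φ x) = f x) → ∀ x, φ x = x}.Nonempty :=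
      ⟨Fintype.card V, Fintype.equivFin V, fun φ h x => (Fintype.equivFin V).injective (h x)⟩
    obtain ⟨g, hg⟩ := Nat.sInf_mem hne
    exact hG _ g hg
  have hle : bD G ≤ 1 :=
    Nat.sInf_le ⟨{e}, by simpa using he, Set.ncard_singleton e, by omega⟩
  have hpos : bD G ≠ 0 := by
    intro h0
    have hne : {k : ℕ | ∃ F : Set (Sym2 V), F ⊆ G.edgeSet ∧ F.ncard = k ∧
        distNum (G.deleteEdges F) ≠ distNum G}.Nonempty :=
      ⟨1, {e}, by simpa using he, Set.ncard_singleton e, by omega⟩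
    obtain ⟨F, -, hF, hF'⟩ := Nat.sInf_mem hne
    have : F.ncard = 0 := hF.trans h0
    rw [Set.ncard_eq_zero (Set.toFinite F)] at this
    subst this
    simp at hF'
  omega

theorem bD_top (n : ℕ) (hn : 3 ≤ n) : bD (⊤ : SimpleGraph (Fin n)) = 1 := by
  have h01 : (⟨0, by omega⟩ : Fin n) ≠ ⟨1, by omega⟩ := by simp
  refine bD_eq_one_of _ s(⟨0, by omega⟩, ⟨1, by omega⟩) (by simp) (n - 1)
    (fun i => if h : i.1 = n - 1 then ⟨0, by omega⟩ else ⟨i.1, by omega⟩) ?_ ?_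
  · intro φ h
    have hv : ∀ x : Fin n, (φ x).1 = x.1 ∨ (x.1 = 0 ∧ (φ x).1 = n - 1) ∨
        (x.1 = n - 1 ∧ (φ x).1 = 0) := by
      intro x
      have := h x
      simp only at this
      split_ifs at this <;> simp at this <;> omega
    have h1 : φ ⟨1, by omega⟩ = ⟨1, by omega⟩ := by
      have := hv ⟨1, by omega⟩
      apply Fin.ext
      simp only at this ⊢
      omega
    have h0 : φ ⟨0, by omega⟩ = ⟨0, by omega⟩ := by
      by_contra hne
      have hadj := φ.map_rel_iff (a := ⟨0, by omega⟩) (b := ⟨1, by omega⟩)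
      rw [h1] at hadj
      have hne1 : φ ⟨0, by omega⟩ ≠ ⟨1, by omega⟩ := by
        exact fun h => h01 (φ.injective (h.trans h1.symm))
      simp [SimpleGraph.deleteEdges_adj, hne, hne1] at hadj
    intro x
    apply Fin.ext
    rcases hv x with h | ⟨hx, h⟩ | ⟨hx, h⟩
    · exact h
    · have : x = ⟨0, by omega⟩ := Fin.ext hx
      rw [this, h0]
    · have : φ x = φ ⟨0, by omega⟩ := by rw [h0]; exact Fin.ext h
      rw [φ.injective this, h0]
  · intro k g hg
    have hinj : Function.Injective g := by
      intro a b hab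
      have := hg ⟨Equiv.swap a b, by simp⟩ (by
        intro x
        simp only [RelIso.coe_fn_mk, Equiv.swap_apply_def]
        split_ifs <;> simp_all) b
      simpa using this
    have := Fintype.card_le_of_injective g hinj
    simp at this
    omega

theorem bip_lower {n m k : ℕ} (g : Fin n ⊕ Fin m → Fin k)
    (hg : IsDist (completeBipartiteGraph (Fin n) (Fin m)) g) (hn : 1 ≤ n) :
    n ≤ k ∧ m ≤ k ∧ (n = m → n < k) := by
  have hA : Function.Injective (fun i => g (Sum.inl i)) := by
    intro a b hab
    have := hg ⟨Equiv.sumCongr (Equiv.swap a b) (Equiv.refl _), by rintro (x | x) (y | y) <;> simp [-Equiv.Perm.sumCongr_swap_refl]⟩ (by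
        rintro (x | x)
        · simp only [RelIso.coe_fn_mk, Equiv.sumCongr_apply, Sum.map_inl, Equiv.swap_apply_def]
          split_ifs <;> simp_all
        · rfl) (Sum.inl b)
    simpa using this
  have hB : Function.Injective (fun i => g (Sum.inr i)) := by
    intro a b hab
    have := hg ⟨Equiv.sumCongr (Equiv.refl _) (Equiv.swap a b), by rintro (x | x) (y | y) <;> simp [-Equiv.Perm.sumCongr_refl_swap]⟩ (by
        rintro (x | x)
        · rfl
        · simp only [RelIso.coe_fn_mk, Equiv.sumCongr_apply, Sum.map_inr, Equiv.swap_apply_def]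
          split_ifs <;> simp_all) (Sum.inr b)
    simpa using this
  have h1 := Fintype.card_le_of_injective _ hA
  have h2 := Fintype.card_le_of_injective _ hB
  simp at h1 h2
  refine ⟨h1, h2, ?_⟩
  rintro rfl
  by_contra hlt
  obtain rfl : k = n := by omega
  let σ := Equiv.ofBijective _ (Finite.injective_iff_bijective.mp hA)
  let τ := Equiv.ofBijective _ (Finite.injective_iff_bijective.mp hB)
  have hσ : ∀ i, σ i = g (Sum.inl i) := fun i => rfl
  have hτ : ∀ i, τ i = g (Sum.inr i) := fun i => rfl
  have := hg ⟨(Equiv.sumCongr (σ.trans τ.symm) (τ.trans σ.symm)).trans (Equiv.sumComm _ _),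
    by rintro (x | x) (y | y) <;> simp⟩ (by
      rintro (x | x)
      · simp [← hτ, ← hσ]
      · simp [← hτ, ← hσ]) (Sum.inl ⟨0, by omega⟩)
  simp at this

theorem bip_upper {n m : ℕ} {α : Type*} (hn : 2 ≤ n) (hm : 2 ≤ m) (f : Fin n ⊕ Fin m → α)
    (u : Fin n) (v : Fin m)
    (hA : ∀ i j : Fin n, i ≠ u → j ≠ u → f (Sum.inl i) = f (Sum.inl j) → i = j)
    (hB : ∀ i j : Fin m, i ≠ v → j ≠ v → f (Sum.inr i) = f (Sum.inr j) → i = j)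
    (huv : n ≠ m ∨ f (Sum.inl u) ≠ f (Sum.inr v)) :
    IsDist ((completeBipartiteGraph (Fin n) (Fin m)).deleteEdges {s(Sum.inl u, Sum.inr v)}) f := by
  set G := (completeBipartiteGraph (Fin n) (Fin m)).deleteEdges {s(Sum.inl u, Sum.inr v)} with hG
  have aLR : ∀ i j, G.Adj (Sum.inl i) (Sum.inr j) ↔ ¬ (i = u ∧ j = v) := by
    intro i j; simp [hG]
  have aRL : ∀ i j, G.Adj (Sum.inr j) (Sum.inl i) ↔ ¬ (i = u ∧ j = v) := by
    intro i j; rw [G.adj_comm, aLR]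
  have aLL : ∀ i j, ¬ G.Adj (Sum.inl i) (Sum.inl j) := by
    intro i j; simp [hG]
  have aRR : ∀ i j, ¬ G.Adj (Sum.inr i) (Sum.inr j) := by
    intro i j; simp [hG]
  have : Nontrivial (Fin n) := Fin.nontrivial_iff_two_le.mpr hn
  have : Nontrivial (Fin m) := Fin.nontrivial_iff_two_le.mpr hm
  obtain ⟨a0, ha0⟩ := exists_ne u
  obtain ⟨b0, hb0⟩ := exists_ne v
  have side : ∀ x y, (∃ z, G.Adj x z ∧ G.Adj y z) ↔ (x.isLeft = y.isLeft) := by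
    rintro (x | x) (y | y)
    · simp only [Sum.isLeft_inl, iff_true]
      exact ⟨Sum.inr b0, by simp [aLR, hb0], by simp [aLR, hb0]⟩
    · simp only [Sum.isLeft_inl, Sum.isLeft_inr]
      simp [aLL, aRR]
    · simp [aLL, aRR]
    · simp only [Sum.isLeft_inr, iff_true]
      exact ⟨Sum.inl a0, by simp [aRL, ha0], by simp [aRL, ha0]⟩
  intro φ h
  have adj : ∀ x y, G.Adj (φ x) (φ y) ↔ G.Adj x y := fun x y => φ.map_rel_iff
  have sideφ : ∀ x y, (φ x).isLeft = (φ y).isLeft ↔ x.isLeft = y.isLeft := by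
    intro x y
    rw [← side, ← side]
    constructor
    · rintro ⟨z, h1, h2⟩
      refine ⟨φ.symm z, ?_, ?_⟩
      · rw [← adj]; simpa using h1
      · rw [← adj]; simpa using h2
    · rintro ⟨z, h1, h2⟩
      exact ⟨φ z, (adj _ _).2 h1, (adj _ _).2 h2⟩
  have hnadj : ¬ G.Adj (φ (Sum.inl u)) (φ (Sum.inr v)) := by rw [adj, aLR]; simp
  have hns : (φ (Sum.inl u)).isLeft ≠ (φ (Sum.inr v)).isLeft := by
    rw [Ne, sideφ]; simp
  have key : (φ (Sum.inl u) = Sum.inl u ∧ φ (Sum.inr v) = Sum.inr v) := by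
    rcases hx : φ (Sum.inl u) with x | x <;> rcases hy : φ (Sum.inr v) with y | y <;>
      rw [hx, hy] at hnadj hns
    · simp at hns
    · simpa [aLR] using hnadj
    · exfalso
      have hxy : y = u ∧ x = v := by
        by_contra hc; exact hnadj ((aRL _ _).2 hc)
      rcases huv with hne | hne
      · -- the sides are swapped
        have e1 : ∀ i : Fin n, ∃ j : Fin m, φ (Sum.inl i) = Sum.inr j := by
          intro i
          have := (sideφ (Sum.inl i) (Sum.inl u)).2 rfl
          rw [hx] at this
          rcases hz : φ (Sum.inl i) with z | z
          · rw [hz] at this; simp at this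
          · exact ⟨z, rfl⟩
        have e2 : ∀ i : Fin m, ∃ j : Fin n, φ (Sum.inr i) = Sum.inl j := by
          intro i
          have := (sideφ (Sum.inr i) (Sum.inr v)).2 rfl
          rw [hy] at this
          rcases hz : φ (Sum.inr i) with z | z
          · exact ⟨z, rfl⟩
          · rw [hz] at this; simp at this
        choose p hp using e1
        choose q hq using e2
        have ip : Function.Injective p := fun a b hab =>
          Sum.inl_injective (φ.injective (by rw [hp, hp, hab]))
        have iq : Function.Injective q := fun a b hab =>
          Sum.inr_injective (φ.injective (by rw [hq, hq, hab]))
        have c1 := Fintype.card_le_of_injective _ ip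
        have c2 := Fintype.card_le_of_injective _ iq
        simp at c1 c2
        omega
      · have := h (Sum.inl u)
        rw [hx, hxy.2] at this
        exact hne this.symm
    · simp at hns
  obtain ⟨ku, kv⟩ := key
  rintro (i | i)
  · by_cases hi : i = u
    · rw [hi, ku]
    have := (sideφ (Sum.inl i) (Sum.inl u)).2 rfl
    rw [ku] at this
    rcases hz : φ (Sum.inl i) with z | z
    · have hzu : z ≠ u := by
        rintro rfl
        exact hi (Sum.inl_injective (φ.injective (hz.trans ku.symm)))
      have hl := h (Sum.inl i)
      rw [hz] at hl
      rw [hA z i hzu hi hl]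
    · rw [hz] at this; simp at this
  · by_cases hi : i = v
    · rw [hi, kv]
    have := (sideφ (Sum.inr i) (Sum.inr v)).2 rfl
    rw [kv] at this
    rcases hz : φ (Sum.inr i) with z | z
    · rw [hz] at this; simp at this
    · have hzu : z ≠ v := by
        rintro rfl
        exact hi (Sum.inr_injective (φ.injective (hz.trans kv.symm)))
      have hl := h (Sum.inr i)
      rw [hz] at hl
      rw [hB z i hzu hi hl]

theorem bD_bip (n m : ℕ) (hn : 3 ≤ n) (hm : 2 ≤ m) :
    bD (completeBipartiteGraph (Fin n) (Fin m)) = 1 := by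
  by_cases hnm : n = m
  · subst hnm
    refine bD_eq_one_of _ s(Sum.inl ⟨0, by omega⟩, Sum.inr ⟨0, by omega⟩) (by simp) n
      (Sum.elim id (fun j => if j.1 = 0 then ⟨1, by omega⟩ else j)) ?_ ?_
    · refine bip_upper (by omega) (by omega) _ _ _ ?_ ?_ (Or.inr ?_)
      · intro i j _ _ h
        simpa using h
      · intro i j hi hj h
        have hi' : i.1 ≠ 0 := fun h => hi (Fin.ext h)
        have hj' : j.1 ≠ 0 := fun h => hj (Fin.ext h)
        simpa [hi', hj'] using h
      · simp
    · intro k g hg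
      exact (bip_lower g hg (by omega)).2.2 rfl
  · refine bD_eq_one_of _ s(Sum.inl ⟨0, by omega⟩, Sum.inr ⟨0, by omega⟩) (by simp) (max n m - 1)
      (Sum.elim (fun i => ⟨i.1 - 1, by omega⟩) (fun j => ⟨j.1 - 1, by omega⟩)) ?_ ?_
    · refine bip_upper (by omega) (by omega) _ _ _ ?_ ?_ (Or.inl hnm)
      · intro i j hi hj h
        have hi' : i.1 ≠ 0 := fun h => hi (Fin.ext h)
        have hj' : j.1 ≠ 0 := fun h => hj (Fin.ext h)
        simp at h
        exact Fin.ext (by omega)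
      · intro i j hi hj h
        have hi' : i.1 ≠ 0 := fun h => hi (Fin.ext h)
        have hj' : j.1 ≠ 0 := fun h => hj (Fin.ext h)
        simp at h
        exact Fin.ext (by omega)
    · intro k g hg
      have := bip_lower g hg (by omega)
      omega

/-- Distinguishing bondage number of complete and complete bipartite graphs. -/
theorem bD_complete_and_completeBipartite (n m : ℕ) (hn : 3 ≤ n) (hm : 2 ≤ m) :
    bD (⊤ : SimpleGraph (Fin n)) = 1 ∧ bD (completeBipartiteGraph (Fin n) (Fin m)) = 1 := by
  exact ⟨bD_top n hn, bD_bip n m hn hm⟩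
end
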